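/- Let X be a separable real Banach space whose dual X* has Property(M*). Then c₀ embeds isomorphically into X if and only if X contains an asymptotically isometric copy of c₀. -/

import Mathlib

open Filter Topology ZeroAtInfty

/-- A sequence converges weakly to zero. -/
def WeakNull {E : Type*} [NormedAddCommGroup E] [NormedSpace ℝ E] (x : ℕ → E) : Prop :=
  ∀ f : E →L[ℝ] ℝ, Tendsto (fun n => f (x n)) atTop (nhds 0)

/-- Property (M). -/
def PropertyM (E : Type*) [NormedAddCommGroup E] [NormedSpace ℝ E] : Prop :=
  ∀ x : ℕ → E, WeakNull x → ∀ u v : E, ‖u‖ ≤ ‖v‖ →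
    Filter.limsup (fun n => ‖x n + u‖) atTop ≤ Filter.limsup (fun n => ‖x n + v‖) atTop

/-- `F` embeds isomorphically into `E`. -/
def EmbedsIso (F E : Type*) [NormedAddCommGroup F] [NormedSpace ℝ F]
    [NormedAddCommGroup E] [NormedSpace ℝ E] : Prop :=
  ∃ T : F →L[ℝ] E, Function.Injective T ∧ ∃ c > (0 : ℝ), ∀ y, c * ‖y‖ ≤ ‖T y‖

/-- Weak normal structure. -/
def WeakNormalStructure (E : Type*) [NormedAddCommGroup E] [NormedSpace ℝ E] : Prop :=
  ∀ C : Set E, Convex ℝ C → IsCompact (toWeakSpace ℝ E '' C) → C.Nontrivial →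
    ∃ x ∈ C, sSup ((fun y => ‖x - y‖) '' C) < Metric.diam C

/-- Property (K). -/
def PropertyK (E : Type*) [NormedAddCommGroup E] [NormedSpace ℝ E] : Prop :=
  ∃ K : ℝ, 0 ≤ K ∧ K < 1 ∧ ∀ (x : ℕ → E) (y : E), WeakNull x →
    Tendsto (fun n => ‖x n‖) atTop (nhds 1) →
    Filter.liminf (fun n => ‖x n - y‖) atTop ≤ 1 → ‖y‖ ≤ K

/-- Kadec-Klee norm. -/
def KadecKlee (E : Type*) [NormedAddCommGroup E] [NormedSpace ℝ E] : Prop :=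
  ∀ (x : ℕ → E) (y : E),
    (∀ f : E →L[ℝ] ℝ, Tendsto (fun n => f (x n)) atTop (nhds (f y))) →
    Tendsto (fun n => ‖x n‖) atTop (nhds ‖y‖) →
    Tendsto (fun n => ‖x n - y‖) atTop (nhds 0)

/-- Opial's modulus. -/
noncomputable def opialModulus (E : Type*) [NormedAddCommGroup E] [NormedSpace ℝ E]
    (c : ℝ) : ℝ :=
  sInf { r : ℝ | ∃ (x : ℕ → E) (y : E), c ≤ ‖y‖ ∧ WeakNull x ∧
    1 ≤ Filter.liminf (fun n => ‖x n‖) atTop ∧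
    r = Filter.liminf (fun n => ‖x n - y‖) atTop - 1 }

/-- A sequence of functionals converges weak-star to zero. -/
def WeakStarNull {E : Type*} [NormedAddCommGroup E] [NormedSpace ℝ E]
    (f : ℕ → (E →L[ℝ] ℝ)) : Prop :=
  ∀ x : E, Tendsto (fun n => f n x) atTop (nhds 0)

/-- Property (M*) of the dual. -/
def PropertyMStar (E : Type*) [NormedAddCommGroup E] [NormedSpace ℝ E] : Prop :=
  ∀ f : ℕ → (E →L[ℝ] ℝ), WeakStarNull f → ∀ u v : E →L[ℝ] ℝ, ‖u‖ ≤ ‖v‖ →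
    Filter.limsup (fun n => ‖f n + u‖) atTop ≤ Filter.limsup (fun n => ‖f n + v‖) atTop

/-- Property (K*) of the dual. -/
def PropertyKStar (E : Type*) [NormedAddCommGroup E] [NormedSpace ℝ E] : Prop :=
  ∃ K : ℝ, 0 ≤ K ∧ K < 1 ∧ ∀ (f : ℕ → (E →L[ℝ] ℝ)) (g : E →L[ℝ] ℝ), WeakStarNull f →
    Tendsto (fun n => ‖f n‖) atTop (nhds 1) →
    Filter.liminf (fun n => ‖f n - g‖) atTop ≤ 1 → ‖g‖ ≤ K

/-- weak* Kadec-Klee norm on the dual. -/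
def WeakStarKadecKlee (E : Type*) [NormedAddCommGroup E] [NormedSpace ℝ E] : Prop :=
  ∀ (f : ℕ → (E →L[ℝ] ℝ)) (g : E →L[ℝ] ℝ),
    (∀ x : E, Tendsto (fun n => f n x) atTop (nhds (g x))) →
    Tendsto (fun n => ‖f n‖) atTop (nhds ‖g‖) →
    Tendsto (fun n => ‖f n - g‖) atTop (nhds 0)

/-- weak* Opial modulus of the dual. -/
noncomputable def weakStarOpialModulus (E : Type*) [NormedAddCommGroup E] [NormedSpace ℝ E]
    (c : ℝ) : ℝ :=
  sInf { r : ℝ | ∃ (f : ℕ → (E →L[ℝ] ℝ)) (g : E →L[ℝ] ℝ), c ≤ ‖g‖ ∧ WeakStarNull f ∧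
    1 ≤ Filter.liminf (fun n => ‖f n‖) atTop ∧
    r = Filter.liminf (fun n => ‖f n - g‖) atTop - 1 }

/-- WORTH* for the dual. -/
def WORTHStar (E : Type*) [NormedAddCommGroup E] [NormedSpace ℝ E] : Prop :=
  ∀ f : ℕ → (E →L[ℝ] ℝ), WeakStarNull f → ∀ g : E →L[ℝ] ℝ,
    Tendsto (fun n => ‖f n - g‖ - ‖f n + g‖) atTop (nhds 0)

/-- Reflexivity of a normed space. -/
def IsReflexive (E : Type*) [NormedAddCommGroup E] [NormedSpace ℝ E] : Prop :=
  Function.Surjective (NormedSpace.inclusionInDoubleDual ℝ E)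

/-- The fixed point property for nonexpansive maps. -/
def FPP (E : Type*) [NormedAddCommGroup E] [NormedSpace ℝ E] : Prop :=
  ∀ C : Set E, C.Nonempty → IsClosed C → Bornology.IsBounded C → Convex ℝ C →
    ∀ T : E → E, Set.MapsTo T C C →
      (∀ x ∈ C, ∀ y ∈ C, ‖T x - T y‖ ≤ ‖x - y‖) → ∃ x ∈ C, T x = x

/-- `E` contains an asymptotically isometric copy of `c₀`. -/
def ContainsAsympIsoC0 (E : Type*) [NormedAddCommGroup E] [NormedSpace ℝ E] : Prop :=
  ∃ ε : ℕ → ℝ, (∀ n, ε n ∈ Set.Ioo (0 : ℝ) 1) ∧ Tendsto ε atTop (nhds 0) ∧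
    ∃ x : ℕ → E, ∀ t : ℕ →₀ ℝ,
      (∀ n, (1 - ε n) * |t n| ≤ ‖∑ n ∈ t.support, t n • x n‖) ∧
      ‖∑ n ∈ t.support, t n • x n‖ ≤ ⨆ n, |t n|

/-- `E` contains an asymptotically isometric copy of `ℓ₁`. -/
def ContainsAsympIsoL1 (E : Type*) [NormedAddCommGroup E] [NormedSpace ℝ E] : Prop :=
  ∃ ε : ℕ → ℝ, (∀ n, ε n ∈ Set.Ioo (0 : ℝ) 1) ∧ Tendsto ε atTop (nhds 0) ∧
    ∃ x : ℕ → E, ∀ t : ℕ →₀ ℝ,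
      (∑ n ∈ t.support, (1 - ε n) * |t n| ≤ ‖∑ n ∈ t.support, t n • x n‖) ∧
      ‖∑ n ∈ t.support, t n • x n‖ ≤ ∑ n ∈ t.support, |t n|


section limsupNorm

variable {E : Type*} [NormedAddCommGroup E]

theorem isCoboundedUnder_le_norm_add (x : ℕ → E) (u : E) :
    IsCoboundedUnder (· ≤ ·) atTop (fun n => ‖x n + u‖) :=
  isCoboundedUnder_le_of_le atTop fun _ => norm_nonneg _

theorem isBoundedUnder_le_norm_add {x : ℕ → E} {C : ℝ} (hC : ∀ n, ‖x n‖ ≤ C) (u : E) :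
    IsBoundedUnder (· ≤ ·) atTop (fun n => ‖x n + u‖) :=
  isBoundedUnder_of ⟨C + ‖u‖, fun n => (norm_add_le _ _).trans (by linarith [hC n])⟩

theorem limsup_norm_add_le {x : ℕ → E} {C : ℝ} (hC : ∀ n, ‖x n‖ ≤ C) (u v : E) :
    limsup (fun n => ‖x n + u‖) atTop ≤ limsup (fun n => ‖x n + v‖) atTop + ‖u - v‖ := by
  refine le_of_forall_pos_lt_add fun η hη => ?_
  have hev := eventually_lt_of_limsup_lt
    (lt_add_of_pos_right (limsup (fun n => ‖x n + v‖) atTop) (half_pos hη))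
    (isBoundedUnder_le_norm_add hC v)
  have : limsup (fun n => ‖x n + u‖) atTop
      ≤ limsup (fun n => ‖x n + v‖) atTop + η / 2 + ‖u - v‖ := by
    refine limsup_le_of_le (isCoboundedUnder_le_norm_add x u) ?_
    filter_upwards [hev] with n hn
    have : x n + u = (x n + v) + (u - v) := by abel
    rw [this]
    exact (norm_add_le _ _).trans (by linarith)
  linarith

end limsupNorm

section PropertyM

variable {E : Type*} [NormedAddCommGroup E] [NormedSpace ℝ E]

theorem WeakNull.exists_norm_le {x : ℕ → E} (hx : WeakNull x) : ∃ C, ∀ n, ‖x n‖ ≤ C := by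
  obtain ⟨C, hC⟩ := banach_steinhaus
    (g := fun n => NormedSpace.inclusionInDoubleDual ℝ E (x n)) fun f => by
      obtain ⟨C, hC⟩ := (hx f).norm.bddAbove_range
      exact ⟨C, fun n => hC ⟨n, rfl⟩⟩
  refine ⟨C, fun n => ?_⟩
  rw [← (NormedSpace.inclusionInDoubleDualLi ℝ (E := E)).norm_map (x n)]
  exact hC n

theorem WeakStarNull.exists_norm_le [CompleteSpace E] {f : ℕ → (E →L[ℝ] ℝ)}
    (hf : WeakStarNull f) : ∃ C, ∀ n, ‖f n‖ ≤ C :=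
  banach_steinhaus fun x => by
    obtain ⟨C, hC⟩ := (hf x).norm.bddAbove_range
    exact ⟨C, fun n => hC ⟨n, rfl⟩⟩

/-- The norm is sequentially weakly lower semicontinuous. -/
theorem WeakNull.norm_le_limsup {x : ℕ → E} (hx : WeakNull x) (u : E) :
    ‖u‖ ≤ limsup (fun n => ‖x n + u‖) atTop := by
  obtain ⟨C, hC⟩ := hx.exists_norm_le
  obtain ⟨f, hf, hfu⟩ := exists_dual_vector'' ℝ u
  have hfu : f u = ‖u‖ := by simpa using hfu
  refine le_of_forall_pos_le_add fun η hη => ?_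
  have : ‖u‖ - η ≤ limsup (fun n => ‖x n + u‖) atTop := by
    refine le_limsup_of_frequently_le (Eventually.frequently ?_)
      (isBoundedUnder_le_norm_add hC u)
    filter_upwards [(hx f).eventually_const_lt (neg_lt_zero.2 hη)] with n hn
    have h1 := (le_abs_self _).trans (f.le_of_opNorm_le hf (x n + u))
    rw [map_add, hfu] at h1
    linarith
  linarith

/-- Every sequence in the dual unit ball of a separable space has a weak-star convergent
subsequence. -/
theorem exists_subseq_tendsto_apply [TopologicalSpace.SeparableSpace E] (f : ℕ → (E →L[ℝ] ℝ))
    (hf : ∀ n, ‖f n‖ ≤ 1) :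
    ∃ g : E →L[ℝ] ℝ, ‖g‖ ≤ 1 ∧ ∃ φ : ℕ → ℕ, StrictMono φ ∧
      ∀ x, Tendsto (fun n => f (φ n) x) atTop (𝓝 (g x)) := by
  obtain ⟨g, hg, φ, hφ, hlim⟩ := WeakDual.isSeqCompact_closedBall (𝕜 := ℝ) (E := E) 0 1
    (x := fun n => StrongDual.toWeakDual (f n)) (fun n => by simpa using hf n)
  refine ⟨WeakDual.toStrongDual g, by simpa using hg, φ, hφ, fun x => ?_⟩
  exact ((WeakDual.eval_continuous x).tendsto g).comp hlim

/-- If the dual of a separable Banach space has property (M*), the space has property (M). -/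
theorem PropertyMStar.propertyM [CompleteSpace E] [TopologicalSpace.SeparableSpace E]
    (hM : PropertyMStar E) : PropertyM E := by
  intro x hx u v huv
  by_contra! hlt
  obtain ⟨C, hC⟩ := hx.exists_norm_le
  obtain ⟨b, hab, hb⟩ := exists_between hlt
  set a := limsup (fun n => ‖x n + v‖) atTop
  obtain ⟨ψ, hψ, hψb⟩ := extraction_of_frequently_atTop
    (frequently_lt_of_lt_limsup (isCoboundedUnder_le_norm_add x u) hb)
  choose f hf hfx using fun n => exists_dual_vector'' ℝ (x (ψ n) + u)
  obtain ⟨f₀, -, θ, hθ, hlim⟩ := exists_subseq_tendsto_apply f hf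
  obtain ⟨e, he, hev⟩ := exists_dual_vector'' ℝ v
  have hev : e v = ‖v‖ := by simpa using hev
  set g : E →L[ℝ] ℝ := ‖f₀‖ • e with hg
  have hgf : ‖g‖ ≤ ‖f₀‖ := by
    rw [hg, norm_smul, norm_norm]
    exact mul_le_of_le_one_right (norm_nonneg _) he
  have hgv : f₀ u ≤ g v := by
    have h1 := (le_abs_self _).trans (f₀.le_opNorm u)
    have h2 : g v = ‖f₀‖ * ‖v‖ := by simp [hg, hev]
    rw [h2]
    exact h1.trans (by gcongr)
  set h : ℕ → (E →L[ℝ] ℝ) := fun n => f (θ n) - f₀ with hh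
  have hnull : WeakStarNull h := fun y => by
    simpa [hh] using (hlim y).sub_const (f₀ y)
  obtain ⟨D, hD⟩ := hnull.exists_norm_le
  have hlimsup : limsup (fun n => ‖h n + g‖) atTop ≤ 1 := by
    refine (hM h hnull g f₀ hgf).trans ?_
    refine limsup_le_of_le (isCoboundedUnder_le_norm_add h f₀) (Eventually.of_forall fun n => ?_)
    simpa [hh] using hf (θ n)
  obtain ⟨η, hηpos, hη⟩ : ∃ η > 0, (1 + η) * (a + η) + η < b := by
    have hcont : Tendsto (fun η : ℝ => (1 + η) * (a + η) + η) (𝓝[>] 0) (𝓝 a) := by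
      have : Continuous fun η : ℝ => (1 + η) * (a + η) + η := by fun_prop
      simpa using (this.tendsto 0).mono_left nhdsWithin_le_nhds
    obtain ⟨η, h1, h2⟩ := ((hcont.eventually_lt_const hab).and self_mem_nhdsWithin).exists
    exact ⟨η, h2, h1⟩
  have hsub : Tendsto (fun n => ψ (θ n)) atTop atTop :=
    (hψ.comp hθ).tendsto_atTop
  have hev1 := eventually_lt_of_limsup_lt (hlimsup.trans_lt (lt_add_of_pos_right 1 hηpos))
    (isBoundedUnder_le_norm_add hD g)
  have hev2 := hsub.eventually (eventually_lt_of_limsup_lt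
    (show limsup (fun n => ‖x n + v‖) atTop < a + η from lt_add_of_pos_right a hηpos)
    (isBoundedUnder_le_norm_add hC v))
  have hev3 : Tendsto (fun n => h n (v - u) + (g - f₀) (x (ψ (θ n)))) atTop (𝓝 0) := by
    simpa using (hnull (v - u)).add ((hx (g - f₀)).comp hsub)
  obtain ⟨n, h1, h2, h3⟩ :=
    (hev1.and (hev2.and (hev3.eventually_const_lt (neg_lt_zero.2 hηpos)))).exists
  have h4 := (le_abs_self _).trans ((h n + g).le_opNorm (x (ψ (θ n)) + v))
  have h5 : ‖h n + g‖ * ‖x (ψ (θ n)) + v‖ ≤ (1 + η) * (a + η) := by gcongr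
  have h6 : b < f (θ n) (x (ψ (θ n)) + u) := by
    have := hfx (θ n)
    simp only [RCLike.ofReal_real_eq_id, id_eq] at this
    rw [this]
    exact hψb (θ n)
  simp only [hh, add_apply, sub_apply, map_add,
    map_sub] at h3 h4 h6
  linarith

end PropertyM

section Blocks

variable {E : Type*} [NormedAddCommGroup E] [NormedSpace ℝ E]

/-- In a space with property (M), a weakly null sequence that is bounded away from zero and has
bounded finite sums admits finite sums `y` of nearly constant norm `L`, such that adding `y` barely
enlarges the ball of radius `L`. -/
theorem PropertyM.exists_flat_block (hM : PropertyM E) {x : ℕ → E} (hx : WeakNull x) {C c : ℝ}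
    (hC : ∀ F : Finset ℕ, ‖∑ n ∈ F, x n‖ ≤ C) (hc : 0 < c) (hxc : ∀ n, c ≤ ‖x n‖) :
    ∃ L > 0, ∀ δ > 0, ∀ U : Set E, U.Finite → (∀ u ∈ U, ‖u‖ < L + δ) →
      ∃ y, L - 2 * δ < ‖y‖ ∧ ∀ u ∈ U, ‖u + y‖ < L + δ := by
  have hxC : ∀ n, ‖x n‖ ≤ C := fun n => by simpa using hC {n}
  have hx0 : 0 < ‖x 0‖ := hc.trans_le (hxc 0)
  set e : E := ‖x 0‖⁻¹ • x 0 with he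
  have hnorm (r : ℝ) : ‖r • e‖ = |r| := by
    rw [he, norm_smul, norm_smul, norm_inv, norm_norm, inv_mul_cancel₀ hx0.ne', mul_one,
      Real.norm_eq_abs]
  set φ : ℝ → ℝ := fun r => limsup (fun n => ‖x n + r • e‖) atTop with hφ
  have hφ_norm (u : E) : limsup (fun n => ‖x n + u‖) atTop = φ ‖u‖ :=
    le_antisymm (hM x hx _ _ (by rw [hnorm, abs_norm])) (hM x hx _ _ (by rw [hnorm, abs_norm]))
  have hφ_mono {r s : ℝ} (hr : 0 ≤ r) (hrs : r ≤ s) : φ r ≤ φ s :=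
    hM x hx _ _ (by rwa [hnorm, hnorm, abs_of_nonneg hr, abs_of_nonneg (hr.trans hrs)])
  have hφ_lip (r s : ℝ) : φ r ≤ φ s + |r - s| := by
    have := limsup_norm_add_le hxC (r • e) (s • e)
    rwa [← sub_smul, hnorm] at this
  have hφ_le (r : ℝ) : r ≤ φ r := by
    have := hx.norm_le_limsup (r • e)
    rw [hnorm] at this
    exact (le_abs_self r).trans this
  have hφ_cont : Continuous φ := by
    refine (LipschitzWith.of_dist_le_mul (K := 1) fun r s => ?_).continuous
    rw [Real.dist_eq, Real.dist_eq, NNReal.coe_one, one_mul, abs_sub_le_iff]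
    have h1 := hφ_lip r s
    have h2 := hφ_lip s r
    rw [abs_sub_comm] at h2
    constructor <;> linarith
  have hφ_lt {r s δ : ℝ} (hr : 0 ≤ r) (hδ : 0 < δ) (hrs : r < s + δ) :
      φ r < φ s + δ := by
    rcases le_total r s with h | h
    · linarith [hφ_mono hr h]
    · have := hφ_lip r s
      rw [abs_of_nonneg (sub_nonneg.2 h)] at this
      linarith
  have hφ_zero : c ≤ φ 0 := by
    refine le_limsup_of_frequently_le (Eventually.frequently (Eventually.of_forall fun n => ?_))
      (isBoundedUnder_le_norm_add hxC _)
    simpa using hxc n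
  set r : ℕ → ℝ := fun k => φ^[k] 0 with hr
  have hr_succ (k : ℕ) : r (k + 1) = φ (r k) := Function.iterate_succ_apply' φ k 0
  have hr_mono : Monotone r := monotone_nat_of_le_succ fun k => by
    rw [hr_succ]
    exact hφ_le _
  have key (L δ : ℝ) (hδ : 0 < δ) (U : Set E) (hU : U.Finite) (hL : ∀ u ∈ U, φ L ≤ L)
      (hUL : ∀ u ∈ U, ‖u‖ < L + δ) (k : ℕ) :
      ∃ F : Finset ℕ, r k - δ < ‖∑ n ∈ F, x n‖ ∧ ∀ u ∈ U, ‖u + ∑ n ∈ F, x n‖ < L + δ := by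
    induction k with
    | zero => exact ⟨∅, by simpa [hr] using hδ, by simpa using hUL⟩
    | succ k ih =>
      obtain ⟨F, hF, hFU⟩ := ih
      set y := ∑ n ∈ F, x n
      have h1 : ∃ᶠ n in atTop, r (k + 1) - δ < ‖x n + y‖ := by
        refine frequently_lt_of_lt_limsup (isCoboundedUnder_le_norm_add x y) ?_
        rw [hφ_norm, hr_succ]
        have := hφ_lt (r := r k) (s := ‖y‖) (hr_mono (Nat.zero_le k)) hδ (by linarith)
        linarith
      have h2 : ∀ᶠ n in atTop, ∀ u ∈ U, ‖x n + (u + y)‖ < L + δ := by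
        refine (hU.eventually_all).2 fun u hu => ?_
        refine eventually_lt_of_limsup_lt ?_ (isBoundedUnder_le_norm_add hxC _)
        rw [hφ_norm]
        have := hφ_lt (norm_nonneg (u + y)) hδ (hFU u hu)
        linarith [hL u hu]
      have h3 : ∀ᶠ n in atTop, n ∉ F := by
        filter_upwards [eventually_gt_atTop (F.sup id)] with n hn hnF
        exact hn.not_ge (Finset.le_sup (f := id) hnF)
      obtain ⟨n, hn1, hn2, hn3⟩ := (h1.and_eventually (h2.and h3)).exists
      refine ⟨insert n F, ?_, fun u hu => ?_⟩
      · rwa [Finset.sum_insert hn3]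
      · rw [Finset.sum_insert hn3, add_left_comm]
        exact hn2 u hu
  have hr_bdd : BddAbove (Set.range r) := by
    refine ⟨C + 1, ?_⟩
    rintro _ ⟨k, rfl⟩
    obtain ⟨F, hF, -⟩ := key 0 1 one_pos ∅ Set.finite_empty (by simp) (by simp) k
    linarith [hC F]
  have hlim := tendsto_atTop_ciSup hr_mono hr_bdd
  set L := ⨆ k, r k
  have hfix : φ L = L := isFixedPt_of_tendsto_iterate hlim hφ_cont.continuousAt
  refine ⟨L, ?_, fun δ hδ U hU hUL => ?_⟩
  · have h1 : r 1 ≤ L := le_ciSup hr_bdd 1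
    have h2 : r 1 = φ 0 := hr_succ 0
    linarith
  · obtain ⟨k, hk⟩ := (hlim.eventually_const_lt (show L - δ < L by linarith)).exists
    obtain ⟨F, hF, hFU⟩ := key L δ hδ U hU (fun _ _ => hfix.le) hUL k
    exact ⟨_, by linarith, hFU⟩

/-- The normalised form of `PropertyM.exists_flat_block`. -/
theorem PropertyM.exists_flat_vector (hM : PropertyM E) {x : ℕ → E} (hx : WeakNull x) {C c : ℝ}
    (hC : ∀ F : Finset ℕ, ‖∑ n ∈ F, x n‖ ≤ C) (hc : 0 < c) (hxc : ∀ n, c ≤ ‖x n‖)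
    {U : Set E} (hU : U.Finite) (hU1 : ∀ u ∈ U, ‖u‖ < 1) {θ : ℝ} (hθ : 0 < θ) :
    ∃ w, 1 - θ < ‖w‖ ∧ ∀ u ∈ U, ‖u + w‖ < 1 := by
  obtain ⟨L, hL, hblock⟩ := hM.exists_flat_block hx hC hc hxc
  have hq : ∀ᶠ q in 𝓝[<] (1 : ℝ), (∀ u ∈ U, ‖u‖ < q) ∧ 1 - θ < q ∧ 0 < q := by
    refine (hU.eventually_all.2 fun u hu => ?_).and (Eventually.and ?_ ?_)
    · exact eventually_nhdsWithin_of_eventually_nhds (lt_mem_nhds (hU1 u hu))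
    · exact eventually_nhdsWithin_of_eventually_nhds (lt_mem_nhds (by linarith))
    · exact eventually_nhdsWithin_of_eventually_nhds (lt_mem_nhds one_pos)
  obtain ⟨q, ⟨hqU, hqθ, hq0⟩, hq1 : q < 1⟩ := (hq.and self_mem_nhdsWithin).exists
  obtain ⟨δ, hδθ, hδ : 0 < δ⟩ : ∃ δ, 1 - θ < q / (L + δ) * (L - 2 * δ) ∧ 0 < δ := by
    have hcont : ContinuousAt (fun δ : ℝ => q / (L + δ) * (L - 2 * δ)) 0 := by
      have : L + 0 ≠ 0 := by simpa using hL.ne'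
      fun_prop (disch := assumption)
    have hlim : Tendsto (fun δ : ℝ => q / (L + δ) * (L - 2 * δ)) (𝓝 0) (𝓝 q) := by
      have := hcont.tendsto
      simpa [hL.ne'] using this
    exact (((hlim.mono_left nhdsWithin_le_nhds).eventually_const_lt hqθ).and
      (self_mem_nhdsWithin : Set.Ioi (0 : ℝ) ∈ 𝓝[>] 0)).exists
  have hLδ : 0 < L + δ := by linarith
  set a := q / (L + δ) with ha
  have ha0 : 0 < a := div_pos hq0 hLδ
  have haL : a * (L + δ) = q := div_mul_cancel₀ q hLδ.ne'
  obtain ⟨y, hy, hyU⟩ := hblock δ hδ ((fun u => a⁻¹ • u) '' U) (hU.image _) (by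
    rintro _ ⟨u, hu, rfl⟩
    rw [norm_smul, norm_inv, Real.norm_of_nonneg ha0.le, inv_mul_lt_iff₀ ha0, haL]
    exact hqU u hu)
  refine ⟨a • y, ?_, fun u hu => ?_⟩
  · rw [norm_smul, Real.norm_of_nonneg ha0.le]
    exact hδθ.trans (by gcongr)
  · have h1 : u + a • y = a • (a⁻¹ • u + y) := by rw [smul_add, smul_inv_smul₀ ha0.ne']
    rw [h1, norm_smul, Real.norm_of_nonneg ha0.le]
    calc a * ‖a⁻¹ • u + y‖ < a * (L + δ) := by gcongr; exact hyU _ ⟨u, hu, rfl⟩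
      _ < 1 := haL ▸ hq1

end Blocks

section FlatSequence

variable {E : Type*} [NormedAddCommGroup E] [NormedSpace ℝ E]

/-- If a unit ball contains vectors of norm close to one that are flat over any prescribed finite
set, then it contains a sequence whose norms tend to one and that satisfies an upper `c₀`-estimate
with constant one. -/
theorem exists_seq_norm_sum_lt_one
    (h : ∀ U : Set E, U.Finite → (∀ u ∈ U, ‖u‖ < 1) → ∀ θ > (0 : ℝ),
      ∃ w, 1 - θ < ‖w‖ ∧ ∀ u ∈ U, ‖u + w‖ < 1)
    {θ : ℕ → ℝ} (hθ : ∀ n, 0 < θ n) :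
    ∃ w : ℕ → E, (∀ n, 1 - θ n < ‖w n‖) ∧
      ∀ t : ℕ → ℝ, (∀ n, |t n| ≤ 1) → ∀ N, ‖∑ n ∈ Finset.range N, t n • w n‖ < 1 := by
  have hstep (n : ℕ) (A : {A : Set E // A.Finite ∧ ∀ a ∈ A, ‖a‖ < 1}) :
      ∃ w : E, 1 - θ n < ‖w‖ ∧ ∀ a ∈ A.1, ‖a + w‖ < 1 ∧ ‖a - w‖ < 1 := by
    obtain ⟨A, hA, hA1⟩ := A
    obtain ⟨w, hw, hwA⟩ := h (A ∪ Neg.neg '' A) (hA.union (hA.image _)) (by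
      rintro u (hu | ⟨a, ha, rfl⟩)
      · exact hA1 u hu
      · rw [norm_neg]; exact hA1 a ha) (θ n) (hθ n)
    refine ⟨w, hw, fun a ha => ⟨hwA a (Or.inl ha), ?_⟩⟩
    rw [norm_sub_rev, sub_eq_neg_add]
    exact hwA (-a) (Or.inr ⟨a, ha, rfl⟩)
  choose step hstep1 hstep2 using hstep
  let state : ℕ → {A : Set E // A.Finite ∧ ∀ a ∈ A, ‖a‖ < 1} := fun n =>
    Nat.rec ⟨{0}, Set.finite_singleton 0, by simp⟩ (fun n A =>
      ⟨(fun a => a + step n A) '' A.1 ∪ (fun a => a - step n A) '' A.1,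
        (A.2.1.image _).union (A.2.1.image _), by
          rintro _ (⟨a, ha, rfl⟩ | ⟨a, ha, rfl⟩)
          · exact (hstep2 n A a ha).1
          · exact (hstep2 n A a ha).2⟩) n
  set w : ℕ → E := fun n => step n (state n) with hw
  have hstate (n : ℕ) : (state (n + 1)).1 =
      (fun a => a + w n) '' (state n).1 ∪ (fun a => a - w n) '' (state n).1 := rfl
  refine ⟨w, fun n => hstep1 n _, fun t ht N => ?_⟩
  have hmem (N : ℕ) : ∑ n ∈ Finset.range N, t n • w n ∈ convexHull ℝ (state N).1 := by
    induction N with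
    | zero => exact subset_convexHull ℝ _ (by simp [state])
    | succ N ih =>
      rw [Finset.sum_range_succ]
      set y := ∑ n ∈ Finset.range N, t n • w n
      have hadd : y + w N ∈ convexHull ℝ (state (N + 1)).1 := by
        have hsub : (fun a => a + w N) '' (state N).1 ⊆ (state (N + 1)).1 := Set.subset_union_left
        refine convexHull_mono hsub ?_
        have := Set.mem_image_of_mem (AffineMap.id ℝ E + AffineMap.const ℝ E (w N)) ih
        rw [AffineMap.image_convexHull] at this
        exact this
      have hsub : y - w N ∈ convexHull ℝ (state (N + 1)).1 := by
        have hsub : (fun a => a - w N) '' (state N).1 ⊆ (state (N + 1)).1 := Set.subset_union_right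
        refine convexHull_mono hsub ?_
        have := Set.mem_image_of_mem (AffineMap.id ℝ E - AffineMap.const ℝ E (w N)) ih
        rw [AffineMap.image_convexHull] at this
        exact this
      have hcomb : y + t N • w N
          = ((1 + t N) / 2) • (y + w N) + ((1 - t N) / 2) • (y - w N) := by module
      rw [hcomb]
      obtain ⟨h1, h2⟩ := abs_le.1 (ht N)
      exact convex_convexHull ℝ _ hadd hsub (by linarith) (by linarith) (by ring)
  have hball : convexHull ℝ (state N).1 ⊆ Metric.ball 0 1 :=
    convexHull_min (fun a ha => by simpa using (state N).2.2 a ha) (convex_ball 0 1)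
  simpa using hball (hmem N)

/-- A sequence with an upper `c₀`-estimate with constant one and norms tending to one spans an
asymptotically isometric copy of `c₀`. -/
theorem containsAsympIsoC0_of_norm_sum_le {θ : ℕ → ℝ} (hθ : ∀ n, 0 < θ n) (hθ4 : ∀ n, θ n ≤ 1 / 4)
    (hθ0 : Tendsto θ atTop (𝓝 0)) {w : ℕ → E} (hw : ∀ n, 1 - θ n ≤ ‖w n‖)
    (hsum : ∀ t : ℕ → ℝ, (∀ n, |t n| ≤ 1) → ∀ N, ‖∑ n ∈ Finset.range N, t n • w n‖ ≤ 1) :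
    ContainsAsympIsoC0 E := by
  set Λ : (ℕ →₀ ℝ) →ₗ[ℝ] E := Finsupp.linearCombination ℝ w
  have hΛ_one (t : ℕ →₀ ℝ) (ht : ∀ n, |t n| ≤ 1) : ‖Λ t‖ ≤ 1 := by
    obtain ⟨N, hN⟩ := t.support.exists_nat_subset_range
    have : Λ t = ∑ n ∈ Finset.range N, t n • w n :=
      Finsupp.sum_of_support_subset _ hN _ (by simp)
    rw [this]
    exact hsum t ht N
  have hΛ (t : ℕ →₀ ℝ) (T : ℝ) (ht : ∀ n, |t n| ≤ T) : ‖Λ t‖ ≤ T := by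
    have hT : 0 ≤ T := (abs_nonneg _).trans (ht 0)
    rcases hT.eq_or_lt with rfl | hT
    · have : t = 0 := Finsupp.ext fun n => abs_nonpos_iff.1 (ht n)
      simp [this]
    · have := hΛ_one (T⁻¹ • t) fun n => by
        rw [Finsupp.smul_apply, smul_eq_mul, abs_mul, abs_inv, abs_of_pos hT, inv_mul_le_iff₀ hT,
          mul_one]
        exact ht n
      rwa [map_smul, norm_smul, norm_inv, Real.norm_of_nonneg hT.le, inv_mul_le_iff₀ hT,
        mul_one] at this
  refine ⟨fun n => 3 * θ n, fun n => ⟨by linarith [hθ n], by linarith [hθ4 n]⟩,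
    by simpa using hθ0.const_mul 3, w, fun t => ?_⟩
  change (∀ n, _ ≤ ‖Λ t‖) ∧ ‖Λ t‖ ≤ _
  have hbdd : BddAbove (Set.range fun n => |t n|) := by
    refine ((t.finite_range.image (fun r => |r|)).subset ?_).bddAbove
    rintro _ ⟨n, rfl⟩
    exact ⟨t n, ⟨n, rfl⟩, rfl⟩
  set T := ⨆ n, |t n|
  have htT (n : ℕ) : |t n| ≤ T := le_ciSup hbdd n
  have hT : 0 ≤ T := (abs_nonneg _).trans (htT 0)
  have hlower (m : ℕ) : |t m| * (1 - θ m) - θ m * T ≤ ‖Λ t‖ := by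
    obtain ⟨s, hs, hst⟩ : ∃ s : ℝ, |s| = T ∧ |t m + s| = |t m| + T := by
      rcases le_total 0 (t m) with h | h
      · exact ⟨T, abs_of_nonneg hT, by rw [abs_of_nonneg h, abs_of_nonneg (by linarith)]⟩
      · exact ⟨-T, by rw [abs_neg, abs_of_nonneg hT],
          by rw [abs_of_nonpos h, abs_of_nonpos (by linarith)]; ring⟩
    have h1 : ‖Λ (Finsupp.single m (t m + s) - t)‖ ≤ T := hΛ _ _ fun n => by
      rcases eq_or_ne n m with rfl | hn
      · simp [hs]
      · simpa [Finsupp.single_apply, hn.symm] using htT n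
    have h2 : ‖Λ (Finsupp.single m (t m + s))‖ = (|t m| + T) * ‖w m‖ := by
      rw [Finsupp.linearCombination_single, norm_smul, Real.norm_eq_abs, hst]
    have h3 : ‖Λ (Finsupp.single m (t m + s))‖ ≤ T + ‖Λ t‖ := by
      have := norm_add_le (Λ (Finsupp.single m (t m + s) - t)) (Λ t)
      rw [← map_add, sub_add_cancel] at this
      linarith
    have h4 : (|t m| + T) * (1 - θ m) ≤ (|t m| + T) * ‖w m‖ :=
      mul_le_mul_of_nonneg_left (hw m) (add_nonneg (abs_nonneg _) hT)
    linarith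
  have hTle : T ≤ 2 * ‖Λ t‖ := by
    have : T ≤ (‖Λ t‖ + T / 4) / (3 / 4) := ciSup_le fun m => by
      rw [le_div_iff₀ (by norm_num)]
      nlinarith [hlower m, hθ4 m, abs_nonneg (t m)]
    linarith
  refine ⟨fun m => ?_, hΛ t T htT⟩
  have h1 : (1 - 3 * θ m) * |t m| * (1 + 2 * θ m) ≤ ‖Λ t‖ * (1 + 2 * θ m) := by
    nlinarith [hlower m, hθ m, abs_nonneg (t m), mul_nonneg (sq_nonneg (θ m)) (abs_nonneg (t m)),
      mul_le_mul_of_nonneg_left hTle (hθ m).le]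
  exact le_of_mul_le_mul_right h1 (by linarith [hθ m])

end FlatSequence

section Embedding

/-- The inclusion of the finitely supported sequences into `c₀`. -/
noncomputable def finsuppToC0 : (ℕ →₀ ℝ) →ₗ[ℝ] C₀(ℕ, ℝ) where
  toFun t :=
    { toFun := t
      continuous_toFun := continuous_of_discreteTopology
      zero_at_infty' := by
        rw [cocompact_eq_cofinite]
        refine tendsto_const_nhds.congr' ?_
        have := t.hasFiniteSupport.eventually_cofinite_notMem
        filter_upwards [this] with n hn
        exact (Function.notMem_support.1 hn).symm }
  map_add' _ _ := rfl
  map_smul' _ _ := rfl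

theorem finsuppToC0_apply (t : ℕ →₀ ℝ) (n : ℕ) : finsuppToC0 t n = t n := rfl

theorem ZeroAtInftyContinuousMap.abs_apply_le_norm (f : C₀(ℕ, ℝ)) (n : ℕ) : |f n| ≤ ‖f‖ :=
  f.toBCF.norm_coe_le_norm n

theorem ZeroAtInftyContinuousMap.norm_le_of_abs_apply_le {f : C₀(ℕ, ℝ)} {C : ℝ} (hC : 0 ≤ C)
    (h : ∀ n, |f n| ≤ C) : ‖f‖ ≤ C :=
  (f.toBCF.norm_le hC).2 h

variable {E : Type*} [NormedAddCommGroup E] [NormedSpace ℝ E]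

/-- A sequence with uniformly bounded signed finite sums is weakly null. -/
theorem weakNull_of_norm_linearCombination_le {x : ℕ → E} {C : ℝ}
    (h : ∀ t : ℕ →₀ ℝ, (∀ n, |t n| ≤ 1) → ‖Finsupp.linearCombination ℝ x t‖ ≤ C) :
    WeakNull x := by
  intro f
  have hsum : Summable fun n => |f (x n)| := by
    refine summable_of_sum_le (c := ‖f‖ * C) (fun _ => abs_nonneg _) fun F => ?_
    set t : ℕ →₀ ℝ := Finsupp.indicator F fun n _ => (SignType.sign (f (x n)) : ℝ) with ht
    have ht1 (n : ℕ) : |t n| ≤ 1 := by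
      rw [ht, Finsupp.indicator_apply]
      split_ifs
      · rcases lt_trichotomy (f (x n)) 0 with h | h | h <;> simp [h]
      · simp
    have hft : f (Finsupp.linearCombination ℝ x t) = ∑ n ∈ F, |f (x n)| := by
      rw [Finsupp.linearCombination_apply, Finsupp.sum_of_support_subset _
        (Finsupp.support_indicator_subset F _) _ (by simp), map_sum]
      refine Finset.sum_congr rfl fun n hn => ?_
      rw [Finsupp.indicator_of_mem hn, map_smul, smul_eq_mul, sign_mul_self]
    rw [← hft]
    exact (le_abs_self _).trans (f.le_opNorm_of_le (h t ht1))
  exact tendsto_zero_iff_abs_tendsto_zero _ |>.2 hsum.tendsto_atTop_zero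

/-- An isomorphic copy of `c₀` yields a `c₀`-like sequence. -/
theorem EmbedsIso.exists_seq (h : EmbedsIso C₀(ℕ, ℝ) E) :
    ∃ (x : ℕ → E) (C c : ℝ), 0 < c ∧ (∀ n, c ≤ ‖x n‖) ∧
      ∀ t : ℕ →₀ ℝ, (∀ n, |t n| ≤ 1) → ‖Finsupp.linearCombination ℝ x t‖ ≤ C := by
  obtain ⟨T, -, c, hc, hT⟩ := h
  refine ⟨fun n => T (finsuppToC0 (Finsupp.single n 1)), ‖T‖, c, hc, fun n => ?_, fun t ht => ?_⟩
  · refine le_trans ?_ (hT _)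
    have := (finsuppToC0 (Finsupp.single n 1)).abs_apply_le_norm n
    rw [finsuppToC0_apply, Finsupp.single_eq_same, abs_one] at this
    exact le_mul_of_one_le_right hc.le this
  · have h1 : Finsupp.linearCombination ℝ (fun n => T (finsuppToC0 (Finsupp.single n 1))) t
        = T (finsuppToC0 t) := by
      have h2 : Finsupp.linearCombination ℝ (fun n => T (finsuppToC0 (Finsupp.single n 1)))
          = (T : C₀(ℕ, ℝ) →ₗ[ℝ] E) ∘ₗ finsuppToC0 := by
        ext n
        simp
      rw [h2]
      rfl
    rw [h1]
    refine T.le_of_opNorm_le_of_le le_rfl ?_ |>.trans (mul_one _).le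
    exact ZeroAtInftyContinuousMap.norm_le_of_abs_apply_le zero_le_one ht

/-- The span of an asymptotically isometric copy of `c₀` is isomorphic to `c₀`. -/
theorem ContainsAsympIsoC0.embedsIso [CompleteSpace E] (h : ContainsAsympIsoC0 E) :
    EmbedsIso C₀(ℕ, ℝ) E := by
  obtain ⟨ε, hε, hε0, x, hx⟩ := h
  obtain ⟨c, hc, hcε⟩ : ∃ c > 0, ∀ n, c ≤ 1 - ε n := by
    obtain ⟨N, hN⟩ := eventually_atTop.1 (hε0.eventually_lt_const (show (0 : ℝ) < 1 / 2 by norm_num))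
    obtain ⟨m, -, hm⟩ := Finset.exists_max_image (Finset.range (N + 1)) ε ⟨0, by simp⟩
    refine ⟨min (1 / 2) (1 - ε m), lt_min (by norm_num) (by linarith [(hε m).2]), fun n => ?_⟩
    rcases le_total N n with h | h
    · exact (min_le_left _ _).trans (by linarith [hN n h])
    · exact (min_le_right _ _).trans (by linarith [hm n (by simp; omega)])
  have hsum_eq (a : ℕ → ℝ) (F : Finset ℕ) :
      ∑ n ∈ (Finsupp.indicator F fun n _ => a n).support,
        (Finsupp.indicator F fun n _ => a n) n • x n = ∑ n ∈ F, a n • x n := by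
    refine (Finset.sum_subset (Finsupp.support_indicator_subset F _) ?_).trans
      (Finset.sum_congr rfl fun n hn => by rw [Finsupp.indicator_of_mem hn])
    intro n _ hn
    rw [Finsupp.notMem_support_iff.1 hn, zero_smul]
  have hlower (a : ℕ → ℝ) (F : Finset ℕ) (n : ℕ) (hn : n ∈ F) :
      c * |a n| ≤ ‖∑ n ∈ F, a n • x n‖ := by
    have := (hx (Finsupp.indicator F fun n _ => a n)).1 n
    rw [hsum_eq, Finsupp.indicator_of_mem hn] at this
    exact (mul_le_mul_of_nonneg_right (hcε n) (abs_nonneg _)).trans this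
  have hupper (a : ℕ → ℝ) (F : Finset ℕ) (C : ℝ) (hC : 0 ≤ C) (ha : ∀ n ∈ F, |a n| ≤ C) :
      ‖∑ n ∈ F, a n • x n‖ ≤ C := by
    have := (hx (Finsupp.indicator F fun n _ => a n)).2
    rw [hsum_eq] at this
    refine this.trans (ciSup_le fun n => ?_)
    rw [Finsupp.indicator_apply]
    split_ifs with hn
    · exact ha n hn
    · simpa using hC
  have hsummable (f : C₀(ℕ, ℝ)) : Summable fun n => f n • x n := by
    rw [summable_iff_vanishing_norm]
    intro δ hδ
    have hf := f.zero_at_infty'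
    rw [cocompact_eq_cofinite] at hf
    have hfin := eventually_cofinite.1
      (((tendsto_zero_iff_abs_tendsto_zero _).1 hf).eventually_lt_const (half_pos hδ))
    refine ⟨hfin.toFinset, fun F hF => (hupper f F (δ / 2) (half_pos hδ).le fun n hn => ?_).trans_lt
      (half_lt_self hδ)⟩
    by_contra! hlt
    exact Finset.disjoint_left.1 hF hn (hfin.mem_toFinset.2 (not_lt.2 hlt.le))
  let T : C₀(ℕ, ℝ) →ₗ[ℝ] E :=
    { toFun := fun f => ∑' n, f n • x n
      map_add' := fun f g => by
        rw [← (hsummable f).tsum_add (hsummable g)]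
        simp [add_smul]
      map_smul' := fun r f => by
        rw [RingHom.id_apply, ← (hsummable f).tsum_const_smul]
        simp [mul_smul] }
  have hT (f : C₀(ℕ, ℝ)) : Tendsto (fun F : Finset ℕ => ‖∑ n ∈ F, f n • x n‖) atTop (𝓝 ‖T f‖) :=
    (hsummable f).hasSum.norm
  have hT_le (f : C₀(ℕ, ℝ)) : ‖T f‖ ≤ 1 * ‖f‖ := by
    rw [one_mul]
    exact le_of_tendsto (hT f) (Eventually.of_forall fun F =>
      hupper f F _ (norm_nonneg f) fun n _ => f.abs_apply_le_norm n)
  have hT_ge (f : C₀(ℕ, ℝ)) : c * ‖f‖ ≤ ‖T f‖ := by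
    rw [← le_div_iff₀' hc]
    refine ZeroAtInftyContinuousMap.norm_le_of_abs_apply_le (by positivity) fun n => ?_
    rw [le_div_iff₀' hc]
    refine ge_of_tendsto (hT f) ?_
    filter_upwards [eventually_ge_atTop {n}] with F hF
    exact hlower f F n (hF (Finset.mem_singleton_self n))
  refine ⟨T.mkContinuous 1 hT_le, ?_, c, hc, hT_ge⟩
  refine (injective_iff_map_eq_zero _).2 fun f hf => ?_
  have h1 := hT_ge f
  rw [show T f = 0 from hf, norm_zero] at h1
  exact norm_le_zero_iff.1 (nonpos_of_mul_nonpos_right h1 hc)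

end Embedding

theorem stmt19 (X : Type*) [NormedAddCommGroup X] [NormedSpace ℝ X] [CompleteSpace X]
    [TopologicalSpace.SeparableSpace X]
    (hM : PropertyMStar X) :
    EmbedsIso C₀(ℕ, ℝ) X ↔ ContainsAsympIsoC0 X := by
  refine ⟨fun h => ?_, fun h => h.embedsIso⟩
  obtain ⟨x, C, c, hc, hxc, hC⟩ := h.exists_seq
  have hx : WeakNull x := weakNull_of_norm_linearCombination_le hC
  have hCF (F : Finset ℕ) : ‖∑ n ∈ F, x n‖ ≤ C := by
    have h1 := hC (Finsupp.indicator F fun _ _ => 1) fun n => by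
      rw [Finsupp.indicator_apply]
      split_ifs <;> simp
    rw [Finsupp.linearCombination_apply, Finsupp.sum_of_support_subset _
      (Finsupp.support_indicator_subset F _) _ (by simp)] at h1
    rwa [Finset.sum_congr rfl fun n hn => by rw [Finsupp.indicator_of_mem hn, one_smul]] at h1
  have hpos (n : ℕ) : (0 : ℝ) < 1 / 4 * (1 / (n + 1)) := by positivity
  obtain ⟨w, hw, hsum⟩ := exists_seq_norm_sum_lt_one
    (fun U hU hU1 θ hθ => hM.propertyM.exists_flat_vector hx hCF hc hxc hU hU1 hθ) hpos
  refine containsAsympIsoC0_of_norm_sum_le hpos (fun n => ?_) ?_ (fun n => (hw n).le)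
    (fun t ht N => (hsum t ht N).le)
  · refine mul_le_of_le_one_right (by norm_num) ?_
    rw [div_le_one (by positivity)]
    linarith [n.cast_nonneg (α := ℝ)]
  · simpa using tendsto_one_div_add_atTop_nhds_zero_nat.const_mul (1 / 4 : ℝ)
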